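/- Let p be a prime and let G be a finite abelian p-group with Davenport constant D(G) ≤ 2·exp(G) − 1, and write n = exp(G). Then for every integer i with 1 ≤ i ≤ max(2n − D(G), ⌊n/2⌋ + 1), we have η_i(G) = 2·D(G) − n + (i − 1). -/

import Mathlib

/-- The zero-sum invariant `s_L(G)`: the smallest positive integer `ℓ` such that every
sequence (multiset) over `G` of length at least `ℓ` contains a nonempty zero-sum
subsequence whose length lies in `L`. -/
noncomputable def zsInv (G : Type*) [AddCommGroup G] (L : Set ℕ) : ℕ :=
  sInf {ℓ : ℕ | 0 < ℓ ∧ ∀ S : Multiset G, ℓ ≤ Multiset.card S →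
    ∃ T : Multiset G, T ≤ S ∧ T ≠ 0 ∧ T.sum = 0 ∧ Multiset.card T ∈ L}

/-- The Davenport constant `D(G)`. -/
noncomputable def davenport (G : Type*) [AddCommGroup G] : ℕ := zsInv G {t | 0 < t}

/-- The η-invariant `η(G) = s_{[1, exp(G)]}(G)`. -/
noncomputable def etaInv (G : Type*) [AddCommGroup G] : ℕ :=
  zsInv G {t | 0 < t ∧ t ≤ AddMonoid.exponent G}

/-- The Erdős–Ginzburg–Ziv constant `s(G) = s_{{exp(G)}}(G)`. -/
noncomputable def egzConst (G : Type*) [AddCommGroup G] : ℕ :=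
  zsInv G {AddMonoid.exponent G}

/-- `η_i(G) = s_{[i, exp(G)]}(G)`. -/
noncomputable def etaI (G : Type*) [AddCommGroup G] (i : ℕ) : ℕ :=
  zsInv G {t | i ≤ t ∧ t ≤ AddMonoid.exponent G}

/-- `ζ_i(G) = s_{[i-n,0] + nℕ⁺}(G)` where `n = exp(G)`: the invariant for zero-sum
subsequences whose length is congruent mod `n` to some residue `r` with `i ≤ r ≤ n`. -/
noncomputable def zetaI (G : Type*) [AddCommGroup G] (i : ℕ) : ℕ :=
  zsInv G {t | 0 < t ∧ ∃ r : ℕ, i ≤ r ∧ r ≤ AddMonoid.exponent G ∧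
    t % AddMonoid.exponent G = r % AddMonoid.exponent G}

/-- The family `e` is a basis of the finite abelian `p`-group `G`, where `e j` has order
`p ^ k j`. -/
structure IsPrimaryBasis {G ι : Type*} [AddCommGroup G] [Fintype ι] (p : ℕ) (e : ι → G)
    (k : ι → ℕ) : Prop where
  span : ∀ g, ∃ c : ι → ℕ, g = ∑ j, c j • e j
  order : ∀ j, p ^ k j • e j = 0
  indep : ∀ c : ι → ℕ, ∑ j, c j • e j = 0 → ∀ j, p ^ k j ∣ c j

theorem exists_isPrimaryBasis {G : Type*} [AddCommGroup G] [Finite G] {p : ℕ} (hp : p.Prime)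
    (hpG : ∀ g : G, ∃ k : ℕ, p ^ k • g = 0) :
    ∃ (ι : Type) (_ : Fintype ι) (_ : Nonempty ι) (e : ι → G) (k : ι → ℕ),
      IsPrimaryBasis p e k := by
  classical
  obtain ⟨ι, _, n, hn, ⟨φ⟩⟩ := AddCommGroup.equiv_directSum_zmod_of_finite' G
  let ψ : G ≃+ (∀ j, ZMod (n j)) := φ.trans (DirectSum.addEquivProd _)
  let e : ι → G := fun j => ψ.symm (Pi.single j 1)
  have hψ (c : ι → ℕ) : ψ (∑ j, c j • e j) = fun j => (c j : ZMod (n j)) := by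
    ext i
    rw [map_sum, Finset.sum_apply, Finset.sum_eq_single i]
    · simp [e]
    · intro j _ hj
      simp [e, Pi.single_eq_of_ne hj.symm]
    · simp
  have hpow (j : ι) : ∃ m, n j = p ^ m := by
    obtain ⟨m, hm⟩ := hpG (e j)
    have h1 : p ^ m • (Pi.single j 1 : ∀ j, ZMod (n j)) = 0 := by
      have := congrArg ψ hm
      simpa [e] using this
    have h2 : ((p ^ m : ℕ) : ZMod (n j)) = 0 := by
      have := congrFun h1 j
      simpa using this
    obtain ⟨i, -, hi⟩ := (Nat.dvd_prime_pow hp).1 ((ZMod.natCast_eq_zero_iff _ _).1 h2)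
    exact ⟨i, hi⟩
  choose k hk using hpow
  refine ⟨Option ι, inferInstance, inferInstance, fun o => o.elim 0 e, fun o => o.elim 0 k,
    ?_, ?_, ?_⟩
  · intro g
    refine ⟨fun o => o.elim 0 fun j => (ψ g j).val, ψ.injective ?_⟩
    have (j : ι) : NeZero (n j) := ⟨by have := hn j; omega⟩
    rw [Fintype.sum_option]
    simp only [Option.elim, smul_zero, zero_add, hψ]
    ext j
    simp
  · rintro (_ | j)
    · simp
    · apply ψ.injective
      have h := hψ (Pi.single j (p ^ k j))
      rw [Fintype.sum_eq_single j (by intro i hi; simp [hi])] at h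
      simp only [Pi.single_eq_same] at h
      simp only [Option.elim, h, map_zero]
      ext i
      by_cases hi : i = j
      · subst hi
        simp [← hk]
      · simp [hi]
  · intro c hc
    rw [Fintype.sum_option] at hc
    simp only [Option.elim, smul_zero, zero_add] at hc
    rintro (_ | j)
    · simp
    · have := congrFun (hψ fun j => c (some j)) j
      rw [hc] at this
      simp only [map_zero, Pi.zero_apply] at this
      simpa [hk] using (ZMod.natCast_eq_zero_iff _ _).1 this.symm

theorem IsPrimaryBasis.exists_exponent {G ι : Type*} [AddCommGroup G] [Fintype ι] [Nonempty ι]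
    {p : ℕ} {e : ι → G} {k : ι → ℕ} (h : IsPrimaryBasis p e k) :
    ∃ r, AddMonoid.exponent G = p ^ k r := by
  classical
  obtain ⟨r, hr⟩ := Finite.exists_max k
  refine ⟨r, Nat.dvd_antisymm ?_ ?_⟩
  · rw [AddMonoid.exponent_dvd_iff_forall_nsmul_eq_zero]
    intro g
    obtain ⟨c, rfl⟩ := h.span g
    rw [Finset.smul_sum]
    refine Finset.sum_eq_zero fun j _ => ?_
    obtain ⟨d, hd⟩ := pow_dvd_pow p (hr j)
    rw [smul_comm, hd, mul_comm, mul_smul, h.order, smul_zero, smul_zero]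
  · have h1 := h.indep (Pi.single r (AddMonoid.exponent G)) (by
      rw [Fintype.sum_eq_single r (by intro i hi; simp [hi]), Pi.single_eq_same,
        AddMonoid.exponent_nsmul_eq_zero]) r
    simpa using h1

/-- The sign-weighted binomial coefficient `(-1) ^ k * (x - 1).choose k`, with value `1` at
`x = 0`. -/
def signedChoose (k : ℕ) : ℕ → ℤ
  | 0 => 1
  | x + 1 => (-1) ^ k * x.choose k

theorem signedChoose_zero_left (x : ℕ) : signedChoose 0 x = 1 := by
  cases x <;> simp [signedChoose]

theorem signedChoose_succ_succ (k x : ℕ) :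
    signedChoose (k + 1) (x + 1) = signedChoose (k + 1) x - signedChoose k x := by
  cases x with
  | zero => simp [signedChoose]
  | succ x =>
    simp only [signedChoose, Nat.choose_succ_succ]
    push_cast
    ring

/-- The sum, in the group algebra, of the subsequences of `S`, weighted by a function of their
length. -/
noncomputable def weightedSubsums (p : ℕ) {G : Type*} [AddCommGroup G] (S : Multiset G) (k : ℕ) :
    AddMonoidAlgebra (ZMod p) G :=
  (S.powerset.map fun T => AddMonoidAlgebra.single T.sum
    (((-1) ^ T.card * signedChoose k T.card : ℤ) : ZMod p)).sum

theorem weightedSubsums_cons_zero (p : ℕ) {G : Type*} [AddCommGroup G] (a : G) (S : Multiset G) :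
    weightedSubsums p (a ::ₘ S) 0 =
      (1 - AddMonoidAlgebra.single a 1) * weightedSubsums p S 0 := by
  simp only [weightedSubsums, Multiset.powerset_cons, Multiset.map_add, Multiset.sum_add,
    Multiset.map_map, sub_mul, one_mul]
  rw [sub_eq_add_neg]
  congr 1
  rw [← neg_mul, ← Multiset.sum_map_mul_left]
  congr 1
  refine Multiset.map_congr rfl fun T _ => ?_
  simp [signedChoose_zero_left, AddMonoidAlgebra.single_mul_single, pow_succ, neg_mul]

theorem weightedSubsums_cons_succ (p : ℕ) {G : Type*} [AddCommGroup G] (a : G) (S : Multiset G)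
    (k : ℕ) :
    weightedSubsums p (a ::ₘ S) (k + 1) =
      (1 - AddMonoidAlgebra.single a 1) * weightedSubsums p S (k + 1) +
        AddMonoidAlgebra.single a 1 * weightedSubsums p S k := by
  have h : weightedSubsums p (a ::ₘ S) (k + 1) = weightedSubsums p S (k + 1) +
      (AddMonoidAlgebra.single a 1 * weightedSubsums p S k -
        AddMonoidAlgebra.single a 1 * weightedSubsums p S (k + 1)) := by
    simp only [weightedSubsums, Multiset.powerset_cons, Multiset.map_add, Multiset.sum_add,
      Multiset.map_map]
    congr 1
    rw [← Multiset.sum_map_mul_left, ← Multiset.sum_map_mul_left, ← Multiset.sum_map_sub]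
    congr 1
    refine Multiset.map_congr rfl fun T _ => ?_
    simp only [Function.comp, Multiset.sum_cons, Multiset.card_cons, signedChoose_succ_succ,
      AddMonoidAlgebra.single_mul_single, one_mul, ← AddMonoidAlgebra.single_sub]
    congr 1
    push_cast
    ring
  rw [h]
  ring

theorem weightedSubsums_mem (p : ℕ) {G : Type*} [AddCommGroup G]
    (J : Ideal (AddMonoidAlgebra (ZMod p) G))
    (hJ : ∀ g, 1 - AddMonoidAlgebra.single g 1 ∈ J) (S : Multiset G) (k : ℕ) :
    weightedSubsums p S k ∈ J ^ (S.card - k) := by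
  induction S using Multiset.induction_on generalizing k with
  | empty => simp
  | cons a S ih =>
    cases k with
    | zero =>
      rw [weightedSubsums_cons_zero, Multiset.card_cons, Nat.sub_zero, pow_succ']
      exact Ideal.mul_mem_mul (hJ a) (ih 0)
    | succ k =>
      rw [weightedSubsums_cons_succ, Multiset.card_cons, Nat.add_sub_add_right]
      refine Ideal.add_mem _ ?_ (Ideal.mul_mem_left _ _ (ih k))
      refine Ideal.pow_le_pow_right (show S.card - k ≤ S.card - (k + 1) + 1 by omega) ?_
      rw [pow_succ']
      exact Ideal.mul_mem_mul (hJ a) (ih (k + 1))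

theorem Finset.sum_pow_eq_zero {R ι : Type*} [CommSemiring R] (s : Finset ι) (f : ι → R)
    (d : ι → ℕ) (h : ∀ j ∈ s, f j ^ (d j + 1) = 0) :
    (∑ j ∈ s, f j) ^ (∑ j ∈ s, d j + 1) = 0 := by
  classical
  induction s using Finset.induction_on with
  | empty => simp
  | insert a s ha ih =>
    rw [Finset.sum_insert ha, Finset.sum_insert ha]
    exact (Commute.all _ _).add_pow_eq_zero_of_add_le_succ_of_pow_eq_zero
      (h a (Finset.mem_insert_self a s)) (ih fun j hj => h j (Finset.mem_insert_of_mem hj))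
      (by omega)

theorem IsPrimaryBasis.weightedSubsums_eq_zero {G ι : Type*} [AddCommGroup G] [Fintype ι]
    {p : ℕ} {e : ι → G} {k : ι → ℕ} (hp : p.Prime) (h : IsPrimaryBasis p e k)
    (S : Multiset G) (m : ℕ) (hS : ∑ j, (p ^ k j - 1) + 1 + m ≤ S.card) :
    weightedSubsums p S m = 0 := by
  have : Fact p.Prime := ⟨hp⟩
  have : CharP (AddMonoidAlgebra (ZMod p) G) p :=
    charP_of_injective_algebraMap (algebraMap (ZMod p) _).injective p
  let x : ι → AddMonoidAlgebra (ZMod p) G := fun j => AddMonoidAlgebra.single (e j) 1 - 1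
  let J : Ideal (AddMonoidAlgebra (ZMod p) G) := ∑ j, Ideal.span {x j}
  have hx (j : ι) : x j ∈ J := by
    have h1 : Ideal.span {x j} ≤ J := Finset.single_le_sum_of_canonicallyOrdered
      (f := fun j => Ideal.span {x j}) (Finset.mem_univ j)
    exact h1 (Ideal.mem_span_singleton_self _)
  have hpow (g : G) (c : ℕ) : (AddMonoidAlgebra.single g 1 : AddMonoidAlgebra (ZMod p) G) ^ c =
      AddMonoidAlgebra.single (c • g) 1 := by
    simp [AddMonoidAlgebra.single_pow]
  have hJ (g : G) : 1 - AddMonoidAlgebra.single g 1 ∈ J := by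
    rw [← Ideal.Quotient.eq, map_one]
    obtain ⟨c, rfl⟩ := h.span g
    have h1 : (AddMonoidAlgebra.single (∑ j, c j • e j) 1 : AddMonoidAlgebra (ZMod p) G) =
        ∏ j, AddMonoidAlgebra.single (e j) 1 ^ c j := by
      simp only [hpow]
      simp
    rw [h1, map_prod]
    refine (Finset.prod_eq_one fun j _ => ?_).symm
    rw [map_pow, ← map_one (Ideal.Quotient.mk J), Ideal.Quotient.eq.2 (hx j), map_one, one_pow]
  have hJ0 : J ^ (∑ j, (p ^ k j - 1) + 1) = 0 := by
    refine Finset.sum_pow_eq_zero _ _ _ fun j _ => ?_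
    rw [Nat.sub_add_cancel (Nat.one_le_pow _ _ hp.pos), Ideal.span_singleton_pow,
      sub_pow_char_pow, hpow, h.order]
    simp [AddMonoidAlgebra.one_def]
  have h2 := weightedSubsums_mem p J hJ S m
  have h3 : J ^ (S.card - m) = 0 := by
    refine le_antisymm ?_ bot_le
    rw [← hJ0]
    exact Ideal.pow_le_pow_right (by omega)
  simpa [h3] using h2

theorem Multiset.sum_map_powerset_eq_of_forall_ne_zero {α M : Type*} [AddCommMonoid M]
    (S : Multiset α) (φ : Multiset α → M) (h : ∀ T ≤ S, T ≠ 0 → φ T = 0) :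
    (S.powerset.map φ).sum = φ 0 := by
  induction S using Multiset.induction_on with
  | empty => simp
  | cons a S ih =>
    rw [Multiset.powerset_cons, Multiset.map_add, Multiset.sum_add, Multiset.map_map,
      ih fun T hT => h T (hT.trans (Multiset.le_cons_self S a))]
    rw [Multiset.sum_eq_zero, add_zero]
    simp only [Multiset.mem_map, Multiset.mem_powerset, Function.comp]
    rintro _ ⟨T, hT, rfl⟩
    exact h _ (Multiset.cons_le_cons a hT) (Multiset.cons_ne_zero)

theorem Nat.Prime.dvd_choose_of_mod_lt {p : ℕ} (hp : p.Prime) (K : ℕ) {k x : ℕ}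
    (hx : x % p ^ K < k) (hk : k < p ^ K) : p ∣ x.choose k := by
  have key (q r : ℕ) (hr : r < k) : p ∣ (p ^ K * q + r).choose k := by
    induction q with
    | zero => simp [Nat.choose_eq_zero_of_lt hr]
    | succ q ih =>
      rw [mul_add, mul_one, add_right_comm, add_comm, Nat.add_choose_eq]
      refine Finset.dvd_sum fun ij hij => ?_
      rw [Finset.HasAntidiagonal.mem_antidiagonal] at hij
      by_cases h0 : ij.1 = 0
      · rw [h0, zero_add] at hij
        rw [hij]
        exact ih.mul_left _
      · exact (hp.dvd_choose_pow h0 (by omega)).mul_right _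
  rw [← Nat.div_add_mod x (p ^ K)]
  exact key _ _ hx

theorem IsPrimaryBasis.exists_zeroSum {G ι : Type*} [AddCommGroup G] [Fintype ι]
    {p : ℕ} {e : ι → G} {k : ι → ℕ} (hp : p.Prime) (h : IsPrimaryBasis p e k) {K m : ℕ}
    (hm : m < p ^ K) (S : Multiset G) (hS : ∑ j, (p ^ k j - 1) + 1 + m ≤ S.card) :
    ∃ T ≤ S, T ≠ 0 ∧ T.sum = 0 ∧ m ≤ (T.card - 1) % p ^ K := by
  classical
  have : Fact p.Prime := ⟨hp⟩
  by_contra! hcon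
  let c : AddMonoidAlgebra (ZMod p) G →+ ZMod p :=
    { toFun := fun f => f.coeff 0, map_zero' := by simp, map_add' := by simp }
  have hc (g : G) (a : ZMod p) : c (AddMonoidAlgebra.single g a) = if g = 0 then a else 0 := by
    change (AddMonoidAlgebra.single g a).coeff 0 = _
    simp [Finsupp.single_apply]
  have h1 : c (weightedSubsums p S m) = 1 := by
    rw [weightedSubsums, map_multiset_sum, Multiset.map_map,
      Multiset.sum_map_powerset_eq_of_forall_ne_zero]
    · simp [hc, signedChoose]
    · intro T hT hT0
      by_cases hs : T.sum = 0
      · obtain ⟨x, hx⟩ : ∃ x, T.card = x + 1 :=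
          ⟨T.card - 1, by have := Multiset.card_pos.2 hT0; omega⟩
        have h2 := hcon T hT hT0 hs
        rw [hx, Nat.add_sub_cancel] at h2
        have h3 := (ZMod.natCast_eq_zero_iff _ _).2 (hp.dvd_choose_of_mod_lt K h2 hm)
        simp [hx, signedChoose, h3]
      · simp [hc, hs]
  rw [h.weightedSubsums_eq_zero hp S m hS, map_zero] at h1
  exact zero_ne_one h1

theorem zsInv_eq_succ {G : Type*} [AddCommGroup G] {L : Set ℕ} {d : ℕ}
    (hup : ∀ S : Multiset G, d + 1 ≤ S.card →
      ∃ T : Multiset G, T ≤ S ∧ T ≠ 0 ∧ T.sum = 0 ∧ T.card ∈ L)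
    {S₀ : Multiset G} (hS₀ : S₀.card = d)
    (hlow : ∀ T ≤ S₀, T ≠ 0 → T.sum = 0 → T.card ∉ L) : zsInv G L = d + 1 := by
  refine le_antisymm (Nat.sInf_le ⟨d.succ_pos, hup⟩) (le_csInf ⟨_, d.succ_pos, hup⟩ ?_)
  rintro l ⟨-, hl⟩
  by_contra! hlt
  obtain ⟨T, hT, hT0, hs, hc⟩ := hl S₀ (by omega)
  exact hlow T hT hT0 hs hc

theorem Multiset.exists_le_map_eq {α β : Type*} (f : α → β) (M : Multiset α) {T : Multiset β}
    (hT : T ≤ M.map f) : ∃ N ≤ M, N.map f = T := by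
  classical
  induction M using Multiset.induction_on generalizing T with
  | empty => exact ⟨0, le_rfl, by simpa [eq_comm] using hT⟩
  | cons a M ih =>
    rw [Multiset.map_cons] at hT
    by_cases ha : f a ∈ T
    · obtain ⟨T, rfl⟩ := Multiset.exists_cons_of_mem ha
      obtain ⟨N, hN, rfl⟩ := ih ((Multiset.cons_le_cons_iff _).1 hT)
      exact ⟨a ::ₘ N, Multiset.cons_le_cons a hN, by simp⟩
    · obtain ⟨N, hN, rfl⟩ := ih ((Multiset.le_cons_of_notMem ha).1 hT)
      exact ⟨N, hN.trans (Multiset.le_cons_self M a), rfl⟩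

/-- The sequence in which `f x` is repeated `c x` times, with its subsequences described by
their multiplicities. -/
theorem exists_multiset_of_multiplicities {G κ : Type*} [AddCommMonoid G] [Fintype κ] (f : κ → G)
    (c : κ → ℕ) : ∃ S : Multiset G, S.card = ∑ x, c x ∧ ∀ T ≤ S, ∃ b : κ → ℕ,
      (∀ x, b x ≤ c x) ∧ T.card = ∑ x, b x ∧ T.sum = ∑ x, b x • f x := by
  classical
  let M : Multiset κ := ∑ x, Multiset.replicate (c x) x
  have hM (x : κ) : M.count x = c x := by
    simp [M, Multiset.count_sum', Multiset.count_replicate]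
  refine ⟨M.map f, by simp [M], fun T hT => ?_⟩
  obtain ⟨N, hN, rfl⟩ := Multiset.exists_le_map_eq f M hT
  refine ⟨fun x => N.count x, fun x => (Multiset.count_le_of_le x hN).trans (hM x).le, ?_, ?_⟩
  · rw [Multiset.card_map]
    exact (Multiset.sum_count_eq_card fun x _ => Finset.mem_univ x).symm
  · rw [Finset.sum_multiset_map_count]
    refine Finset.sum_subset (Finset.subset_univ _) fun x _ hx => ?_
    rw [Multiset.count_eq_zero_of_notMem (by simpa using hx), zero_smul]

theorem IsPrimaryBasis.davenport_eq {G ι : Type*} [AddCommGroup G] [Fintype ι]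
    {p : ℕ} {e : ι → G} {k : ι → ℕ} (hp : p.Prime) (h : IsPrimaryBasis p e k) :
    davenport G = ∑ j, (p ^ k j - 1) + 1 := by
  obtain ⟨S, hS, hsub⟩ := exists_multiset_of_multiplicities e (fun j => p ^ k j - 1)
  refine zsInv_eq_succ (fun S hS => ?_) hS fun T hT hT0 hs _ => ?_
  · obtain ⟨T, hT, hT0, hs, -⟩ := h.exists_zeroSum hp (K := 0) (m := 0) (by simp) S hS
    exact ⟨T, hT, hT0, hs, Multiset.card_pos.2 hT0⟩
  · obtain ⟨b, hb, hcard, hsum⟩ := hsub T hT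
    have h1 := h.indep b (hsum.symm.trans hs)
    have h2 (j : ι) : b j = 0 := by
      refine Nat.eq_zero_of_dvd_of_lt (h1 j) ?_
      have := hb j
      have := Nat.pow_pos (n := k j) hp.pos
      omega
    apply hT0
    rw [← Multiset.card_eq_zero, hcard]
    simp [h2]

theorem IsPrimaryBasis.exists_no_zeroSum {G ι : Type*} [AddCommGroup G] [Fintype ι]
    {p : ℕ} {e : ι → G} {k : ι → ℕ} (hp : p.Prime) (h : IsPrimaryBasis p e k) (r : ι)
    {i : ℕ} (hi : 1 ≤ i) :
    ∃ S : Multiset G, S.card + p ^ k r = 2 * ∑ j, (p ^ k j - 1) + i ∧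
      ∀ T ≤ S, T.sum = 0 → ¬ (i ≤ T.card ∧ T.card ≤ p ^ k r) := by
  classical
  let f : Option (ι ⊕ ι) → G := fun o => o.elim 0 (Sum.elim e fun j => e j + e r)
  let c : Option (ι ⊕ ι) → ℕ := fun o => o.elim (i - 1)
    (Sum.elim (fun j => p ^ k j - 1) fun j => if j = r then 0 else p ^ k j - 1)
  have hpos (j : ι) : 0 < p ^ k j := Nat.pow_pos hp.pos
  obtain ⟨S, hS, hsub⟩ := exists_multiset_of_multiplicities f c
  refine ⟨S, ?_, fun T hT hs hcard => ?_⟩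
  · have h1 : ∑ j, (if j = r then 0 else p ^ k j - 1) + (p ^ k r - 1) = ∑ j, (p ^ k j - 1) := by
      rw [← Finset.add_sum_erase _ _ (Finset.mem_univ r),
        ← Finset.add_sum_erase _ (fun j => p ^ k j - 1) (Finset.mem_univ r), if_pos rfl, zero_add,
        add_comm]
      congr 1
      exact Finset.sum_congr rfl fun j hj => if_neg (Finset.ne_of_mem_erase hj)
    rw [hS, Fintype.sum_option, Fintype.sum_sum_type]
    simp only [c, Option.elim, Sum.elim_inl, Sum.elim_inr]
    have := hpos r
    omega
  · obtain ⟨b, hb, hbc, hbs⟩ := hsub T hT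
    rw [Fintype.sum_option, Fintype.sum_sum_type] at hbc hbs
    set z := b none
    set x : ι → ℕ := fun j => b (some (Sum.inl j))
    set y : ι → ℕ := fun j => b (some (Sum.inr j))
    have hz : z ≤ i - 1 := hb none
    have hx (j : ι) : x j < p ^ k j := by
      have : x j ≤ p ^ k j - 1 := hb (some (Sum.inl j))
      have := hpos j
      omega
    have hyr : y r = 0 := by simpa [c] using hb (some (Sum.inr r))
    have hy (j : ι) : y j < p ^ k j := by
      by_cases hj : j = r
      · rw [hj, hyr]; exact hpos r
      · have : y j ≤ p ^ k j - 1 := by simpa [c, hj] using hb (some (Sum.inr j))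
        have := hpos j
        omega
    have hsum : ∑ j, (x j + y j + (Pi.single r (∑ l, y l) : ι → ℕ) j) • e j = 0 := by
      rw [← hs, hbs]
      simp only [add_smul, Finset.sum_add_distrib]
      rw [Fintype.sum_eq_single (f := fun j => (Pi.single r (∑ l, y l) : ι → ℕ) j • e j) r
        (by intro j hj; simp [hj])]
      simp [f, x, y, smul_add, Finset.sum_add_distrib, Finset.sum_smul, add_assoc]
    have hdvd := h.indep _ hsum
    have hr : p ^ k r ∣ x r + ∑ l, y l := by simpa [hyr] using hdvd r
    have hne {j : ι} (hj : j ≠ r) : p ^ k j ∣ x j + y j := by simpa [hj] using hdvd j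
    have hxs := Finset.add_sum_erase Finset.univ x (Finset.mem_univ r)
    have hbc' : T.card = z + (∑ j, x j + ∑ j, y j) := hbc
    rcases Nat.eq_zero_or_pos (x r + ∑ l, y l) with h0 | h0
    · have hy0 (j : ι) : y j = 0 := by
        have := Finset.single_le_sum_of_canonicallyOrdered (f := y) (Finset.mem_univ j)
        omega
      have hx0 : ∑ j ∈ Finset.univ.erase r, x j = 0 := by
        refine Finset.sum_eq_zero fun j hj => ?_
        have h1 := hne (Finset.ne_of_mem_erase hj)
        rw [hy0, add_zero] at h1
        exact Nat.eq_zero_of_dvd_of_lt h1 (hx j)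
      omega
    · have h1 := Nat.le_of_dvd h0 hr
      have hx0 : ∑ j ∈ Finset.univ.erase r, x j = 0 := by omega
      have hy0 : ∑ j, y j = 0 := by
        refine Finset.sum_eq_zero fun j _ => ?_
        by_cases hj : j = r
        · rw [hj, hyr]
        · have h2 := hne hj
          rw [Finset.sum_eq_zero_iff.1 hx0 j (Finset.mem_erase.2 ⟨hj, Finset.mem_univ j⟩),
            zero_add] at h2
          exact Nat.eq_zero_of_dvd_of_lt h2 (hy j)
      have := hx r
      omega

/-- The upper bound for `η_i` in the range `i ≤ 2 * n - D`. The proof takes a longest zero-sum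
subsequence `W` of length less than `i` that is built from zero-sum pieces of length at most
`D - n`; such pieces are too short to jump over the interval `[i, n]`. -/
theorem exists_zeroSum_card_mem_Icc_of_le {G : Type*} [AddCommGroup G] {D n i : ℕ}
    (hnD : n ≤ D) (hi1 : 1 ≤ i) (hi2 : D + i ≤ 2 * n)
    (hzeta : ∀ m < n, ∀ S : Multiset G, D + m ≤ S.card →
      ∃ T ≤ S, T ≠ 0 ∧ T.sum = 0 ∧ m ≤ (T.card - 1) % n)
    (S : Multiset G) (hS : 2 * D + (i - 1) ≤ S.card + n) :
    ∃ T ≤ S, T.sum = 0 ∧ i ≤ T.card ∧ T.card ≤ n := by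
  classical
  obtain ⟨S', hS', hcard⟩ : ∃ S' ≤ S, S'.card + n = 2 * D + (i - 1) := by
    have hpos : 0 < (S.powersetCard (2 * D + (i - 1) - n)).card := by
      rw [Multiset.card_powersetCard]
      exact Nat.choose_pos (by omega)
    obtain ⟨S', hS'⟩ := Multiset.card_pos_iff_exists_mem.1 hpos
    rw [Multiset.mem_powersetCard] at hS'
    exact ⟨S', hS'.1, by omega⟩
  suffices h : ∃ T ≤ S', T.sum = 0 ∧ i ≤ T.card ∧ T.card ≤ n by
    obtain ⟨T, hT, h⟩ := h
    exact ⟨T, hT.trans hS', h⟩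
  clear hS hS' S
  by_contra! hcon
  let P : Multiset G → Prop := fun W => W ≤ S' ∧ W.sum = 0 ∧ W.card < i ∧
    ∀ m < i, i ≤ m + W.card → ∃ V ≤ W, V.sum = 0 ∧ i ≤ m + V.card ∧ m + V.card ≤ n
  obtain ⟨W, ⟨hWS, hW0, hWi, hW⟩, hmax⟩ : ∃ W, P W ∧ ∀ V, P V → V.card ≤ W.card := by
    have hfin : {W | P W}.Finite := (Set.finite_Iic S').subset fun W hW => hW.1
    obtain ⟨W, hW, h⟩ := Set.exists_max_image _ Multiset.card hfin
      ⟨0, Multiset.zero_le _, by simp, by rwa [Multiset.card_zero], fun m hm h => by simp at h; omega⟩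
    exact ⟨W, hW, h⟩
  have hsmall : ∀ V ≤ S' - W, V ≠ 0 → V.sum = 0 → D < V.card + n := by
    intro V hV hV0 hVs
    by_contra! hVc
    have hV1 := Multiset.card_pos.2 hV0
    have hle : W + V ≤ S' := by
      rw [add_comm]
      exact (le_tsub_iff_right hWS).1 hV
    have hsum : (W + V).sum = 0 := by rw [Multiset.sum_add, hW0, hVs, add_zero]
    have hWV := hcon (W + V) hle hsum
    rw [Multiset.card_add] at hWV
    have hlt : W.card + V.card < i := by
      by_contra! h
      have := hWV h
      omega
    have h1 := hmax (W + V) ⟨hle, hsum, by rwa [Multiset.card_add], fun m hm h => ?_⟩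
    · rw [Multiset.card_add] at h1
      omega
    · rw [Multiset.card_add] at h
      by_cases h2 : i ≤ m + W.card
      · obtain ⟨U, hU, hU'⟩ := hW m hm h2
        exact ⟨U, hU.trans (Multiset.le_add_right W V), hU'⟩
      · exact ⟨W + V, le_rfl, hsum, by rw [Multiset.card_add]; omega,
          by rw [Multiset.card_add]; omega⟩
  have hlarge : ∀ X ≤ S' - W, X.sum = 0 → X.card ≤ n → X.card + W.card < i := by
    intro X hX hXs hXn
    by_contra! h
    have hle : X + W ≤ S' := (le_tsub_iff_right hWS).1 hX
    have h1 : X.card < i := by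
      by_contra! h1
      have := hcon X (hX.trans tsub_le_self) hXs h1
      omega
    obtain ⟨V, hV, hVs, hVi, hVn⟩ := hW _ h1 h
    have := hcon (X + V) ((add_le_add_right hV X).trans hle)
      (by rw [Multiset.sum_add, hXs, hVs, add_zero]) (by rwa [Multiset.card_add])
    rw [Multiset.card_add] at this
    omega
  have hcardSW : (S' - W).card + W.card = S'.card := by
    rw [← Multiset.card_add, tsub_add_cancel_of_le hWS]
  have hmod (x m : ℕ) (hx : x - 1 < 2 * n + m) (hx0 : 0 < x) (hm : m ≤ (x - 1) % n) :
      (m < x ∧ x ≤ n) ∨ (n + m < x ∧ x ≤ 2 * n) := by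
    have h1 := Nat.div_add_mod (x - 1) n
    have h2 := Nat.mod_lt (x - 1) (show 0 < n by omega)
    generalize (x - 1) / n = q at *
    match q with
    | 0 => left; omega
    | 1 => right; omega
    | q + 2 =>
      have : n * (q + 2) = n * q + 2 * n := by ring
      omega
  obtain ⟨X, hX, hX0, hXs, hXm⟩ := hzeta (D + (i - 1) - n - W.card) (by omega) (S' - W) (by omega)
  have hXc := Multiset.card_le_card hX
  rcases hmod _ _ (by omega) (Multiset.card_pos.2 hX0) hXm with ⟨h1, h2⟩ | ⟨h1, h2⟩
  · have := hlarge X hX hXs h2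
    omega
  obtain ⟨x, hx⟩ := Multiset.exists_mem_of_ne_zero hX0
  have hec : (X.erase x).card = X.card - 1 := Multiset.card_erase_of_mem hx
  obtain ⟨Y, hY, hY0, hYs, hYm⟩ := hzeta (X.card - 1 - D) (by omega) (X.erase x) (by omega)
  have hYc := Multiset.card_le_card hY
  have hYX : Y ≤ X := hY.trans (Multiset.erase_le x X)
  rcases hmod _ _ (by omega) (Multiset.card_pos.2 hY0) hYm with ⟨h3, h4⟩ | ⟨h3, h4⟩
  · have := hlarge Y (hYX.trans hX) hYs h4
    omega
  · have hZ : (X - Y).card + Y.card = X.card := by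
      rw [← Multiset.card_add, tsub_add_cancel_of_le hYX]
    have hZs : (X - Y).sum = 0 := by
      have := congrArg Multiset.sum (tsub_add_cancel_of_le hYX)
      rwa [Multiset.sum_add, hYs, hXs, add_zero] at this
    have := hsmall (X - Y) (tsub_le_self.trans hX)
      (by rw [← Multiset.card_pos]; have := Multiset.card_pos.2 hX0; omega) hZs
    omega

theorem exists_zeroSum_card_mem_Icc_of_le_half {G : Type*} [AddCommGroup G] {d n i : ℕ}
    (hi1 : 1 ≤ i) (hi2 : 2 * (i - 1) ≤ n)
    (heta : ∀ S : Multiset G, d ≤ S.card → ∃ T ≤ S, T.sum = 0 ∧ 1 ≤ T.card ∧ T.card ≤ n)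
    (S : Multiset G) (hS : d + (i - 1) ≤ S.card) :
    ∃ T ≤ S, T.sum = 0 ∧ i ≤ T.card ∧ T.card ≤ n := by
  classical
  by_contra! hcon
  have hfin : {W | W ≤ S ∧ W.sum = 0 ∧ W.card < i}.Finite :=
    (Set.finite_Iic S).subset fun W hW => hW.1
  obtain ⟨W, ⟨hWS, hW0, hWi⟩, hmax⟩ := Set.exists_max_image _ Multiset.card hfin
    ⟨0, Multiset.zero_le _, by simp, by rwa [Multiset.card_zero]⟩
  have hcard : (S - W).card + W.card = S.card := by
    rw [← Multiset.card_add, tsub_add_cancel_of_le hWS]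
  obtain ⟨V, hV, hVs, hV1, hVn⟩ := heta (S - W) (by omega)
  have hVi : V.card < i := by
    by_contra! h
    have := hcon V (hV.trans tsub_le_self) hVs h
    omega
  have hle : V + W ≤ S := (le_tsub_iff_right hWS).1 hV
  have hsum : (V + W).sum = 0 := by rw [Multiset.sum_add, hVs, hW0, add_zero]
  by_cases h : V.card + W.card < i
  · have := hmax (V + W) ⟨hle, hsum, by rwa [Multiset.card_add]⟩
    rw [Multiset.card_add] at this
    omega
  · have := hcon (V + W) hle hsum (by rw [Multiset.card_add]; omega)
    rw [Multiset.card_add] at this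
    omega

/-- For a finite abelian `p`-group `G` with `D(G) ≤ 2n − 1` (`n = exp(G)`)
and `1 ≤ i ≤ max(2n − D(G), ⌊n/2⌋ + 1)`, we have `η_i(G) = 2·D(G) − n + (i − 1)`. -/
theorem stmt5 (p : ℕ) (hp : p.Prime) (G : Type*) [AddCommGroup G] [Finite G]
    (hpG : ∀ g : G, ∃ k : ℕ, p ^ k • g = 0)
    (hD : davenport G ≤ 2 * AddMonoid.exponent G - 1)
    (i : ℕ) (hi1 : 1 ≤ i)
    (hi2 : i ≤ max (2 * AddMonoid.exponent G - davenport G) (AddMonoid.exponent G / 2 + 1)) :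
    etaI G i = 2 * davenport G - AddMonoid.exponent G + (i - 1) := by
  obtain ⟨ι, _, _, e, k, h⟩ := exists_isPrimaryBasis hp hpG
  obtain ⟨r, hr⟩ := h.exists_exponent
  have hDeq := h.davenport_eq hp
  have hzeta : ∀ m < AddMonoid.exponent G, ∀ S : Multiset G, davenport G + m ≤ S.card →
      ∃ T ≤ S, T ≠ 0 ∧ T.sum = 0 ∧ m ≤ (T.card - 1) % AddMonoid.exponent G := by
    rw [hDeq, hr]
    exact fun m hm S hS => h.exists_zeroSum hp hm S hS
  obtain ⟨S₀, hS₀, hlow⟩ := h.exists_no_zeroSum hp r hi1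
  rw [← hr] at hS₀ hlow
  have hpos : 0 < AddMonoid.exponent G := hr ▸ Nat.pow_pos hp.pos
  have hnD : AddMonoid.exponent G ≤ davenport G := by
    have := Finset.single_le_sum_of_canonicallyOrdered (f := fun j => p ^ k j - 1)
      (Finset.mem_univ r)
    rw [hDeq, hr]
    omega
  have hup (S : Multiset G)
      (hS : 2 * davenport G - AddMonoid.exponent G + (i - 1) ≤ S.card) :
      ∃ T ≤ S, T.sum = 0 ∧ i ≤ T.card ∧ T.card ≤ AddMonoid.exponent G := by
    rcases le_max_iff.1 hi2 with hi | hi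
    · exact exists_zeroSum_card_mem_Icc_of_le hnD hi1 (by omega) hzeta S (by omega)
    · exact exists_zeroSum_card_mem_Icc_of_le_half hi1 (by omega) (fun T hT =>
        exists_zeroSum_card_mem_Icc_of_le hnD le_rfl (by omega) hzeta T (by omega)) S hS
  have hlen : 2 * davenport G - AddMonoid.exponent G + (i - 1) = S₀.card + 1 := by omega
  rw [hlen] at hup ⊢
  refine zsInv_eq_succ (fun S hS => ?_) rfl fun T hT _ hs => hlow T hT hs
  obtain ⟨T, hT, hs, hc⟩ := hup S hS
  exact ⟨T, hT, Multiset.card_pos.1 (by omega), hs, hc⟩
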